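/- arXiv:1408.2112 — 2 statements merged into one kernel-verified Lean document; each statement's English description precedes it below -/
import Mathlib

section
/- Let (X,T) be a minimal Cantor system and let α ∈ I(X,T) with 0 < α < 1. Then there exists a clopen set U ⊆ X such that μ(U) = α for every μ ∈ M(X,T). -/
open MeasureTheory

open Filter Topology Set

section InvariantMeasures

variable {X : Type*} [TopologicalSpace X] [CompactSpace X] [MeasurableSpace X] [BorelSpace X]

theorem ContinuousMap.integrable_of_compactSpace (g : C(X, ℝ)) (μ : Measure X)
    [IsFiniteMeasure μ] : Integrable g μ :=
  (BoundedContinuousFunction.mkOfCompact g).integrable μ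

/-- The uniform probability measure on the first `n + 1` points of the orbit of `x`. -/
noncomputable def empiricalMeasure (T : X → X) (n : ℕ) (x : X) : Measure X :=
  ((n : ENNReal) + 1)⁻¹ • ∑ i ∈ Finset.range (n + 1), Measure.dirac (T^[i] x)

instance isProbabilityMeasure_empiricalMeasure (T : X → X) (n : ℕ) (x : X) :
    IsProbabilityMeasure (empiricalMeasure T n x) := by
  constructor
  simp only [empiricalMeasure, Measure.smul_apply, Measure.finsetSum_apply, measure_univ,
    Finset.sum_const, Finset.card_range, smul_eq_mul, nsmul_eq_mul, mul_one]
  push_cast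
  exact ENNReal.inv_mul_cancel (by simp) (by finiteness)

theorem integral_empiricalMeasure (T : X → X) (n : ℕ) (x : X) (g : C(X, ℝ)) :
    ∫ y, g y ∂(empiricalMeasure T n x) = ((n : ℝ) + 1)⁻¹ * birkhoffSum T g (n + 1) x := by
  rw [empiricalMeasure, integral_smul_measure,
    integral_finsetSum_measure fun i _ => g.integrable_of_compactSpace _]
  have h : (((n : ENNReal) + 1)⁻¹).toReal = ((n : ℝ) + 1)⁻¹ := by
    rw [ENNReal.toReal_inv, ENNReal.toReal_add (by finiteness) (by finiteness)]
    simp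
  simp only [h, smul_eq_mul, birkhoffSum]
  congr 1
  refine Finset.sum_congr rfl fun i _ => ?_
  exact integral_dirac' _ _ g.continuous.stronglyMeasurable

variable [TopologicalSpace.MetrizableSpace X]

/-- If a continuous function has positive integral against every invariant probability measure,
then its long Birkhoff sums are uniformly positive. -/
theorem exists_forall_birkhoffSum_pos (T : X ≃ₜ X) (g : C(X, ℝ))
    (hg : ∀ μ : Measure X, IsProbabilityMeasure μ → Measure.map T μ = μ → 0 < ∫ x, g x ∂μ) :
    ∃ N : ℕ, ∀ n, N ≤ n → ∀ x, 0 < birkhoffSum T g n x := by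
  by_contra! hcon
  have hfreq : ∃ᶠ n in atTop, ∃ x, birkhoffSum T g (n + 1) x ≤ 0 := by
    rw [frequently_atTop]
    intro a
    obtain ⟨n, hn, x, hx⟩ := hcon (a + 1)
    refine ⟨n - 1, by omega, x, ?_⟩
    rwa [Nat.sub_add_cancel (by omega)]
  obtain ⟨x₀, -⟩ := hfreq.exists.choose_spec
  have : Nonempty X := ⟨x₀⟩
  let p : ℕ → Prop := fun n => ∃ x, birkhoffSum T g (n + 1) x ≤ 0
  have hx : ∀ n, ∃ x, p n → birkhoffSum T g (n + 1) x ≤ 0 := fun n => by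
    by_cases h : p n
    · exact ⟨h.choose, fun _ => h.choose_spec⟩
    · exact ⟨x₀, fun h' => absurd h' h⟩
  choose x hx using hx
  have : NeBot (atTop ⊓ 𝓟 {n | p n}) := frequently_iff_neBot.mp hfreq
  let 𝒰 : Ultrafilter ℕ := Ultrafilter.of (atTop ⊓ 𝓟 {n | p n})
  have h𝒰 : (𝒰 : Filter ℕ) ≤ atTop ⊓ 𝓟 {n | p n} := Ultrafilter.of_le _
  have h𝒰p : ∀ᶠ n in (𝒰 : Filter ℕ), p n := h𝒰.trans inf_le_right (mem_principal_self _)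
  let ν : ℕ → ProbabilityMeasure X := fun n => ⟨empiricalMeasure T n (x n), inferInstance⟩
  obtain ⟨μ, -, hμ⟩ := isCompact_univ.ultrafilter_le_nhds (𝒰.map ν) (by simp)
  have hlim : ∀ φ : C(X, ℝ), Tendsto
      (fun n : ℕ => ((n : ℝ) + 1)⁻¹ * birkhoffSum T φ (n + 1) (x n)) 𝒰
      (𝓝 (∫ y, φ y ∂(μ : Measure X))) := by
    intro φ
    have h := ProbabilityMeasure.tendsto_iff_forall_integral_tendsto.mp
      (show Tendsto ν 𝒰 (𝓝 μ) from hμ) (BoundedContinuousFunction.mkOfCompact φ)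
    refine h.congr fun n => ?_
    exact integral_empiricalMeasure T n (x n) φ
  have hinv : Measure.map T (μ : Measure X) = μ := by
    have : IsProbabilityMeasure (Measure.map T (μ : Measure X)) :=
      Measure.isProbabilityMeasure_map T.continuous.aemeasurable
    refine ext_of_forall_integral_eq_of_IsFiniteMeasure fun φ => ?_
    rw [integral_map T.continuous.aemeasurable φ.continuous.aestronglyMeasurable]
    have h1 := hlim (φ.toContinuousMap.comp T)
    have h2 := hlim φ.toContinuousMap
    refine sub_eq_zero.mp (tendsto_nhds_unique (h1.sub h2) ?_)
    have h0 : Tendsto (fun n : ℕ => ((n : ℝ) + 1)⁻¹ * (2 * ‖φ‖)) 𝒰 (𝓝 0) := by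
      have := (tendsto_one_div_add_atTop_nhds_zero_nat (𝕜 := ℝ)).mul_const (2 * ‖φ‖)
      simp only [one_div, zero_mul] at this
      exact this.mono_left (h𝒰.trans inf_le_left)
    refine squeeze_zero_norm (fun n => ?_) h0
    have hsum : birkhoffSum T (φ.toContinuousMap.comp (T : C(X, X))) (n + 1) (x n)
        = birkhoffSum T φ (n + 1) (T (x n)) := by
      simp only [birkhoffSum, ← Function.iterate_succ_apply, Function.iterate_succ_apply']
      rfl
    rw [← mul_sub, hsum, norm_mul, norm_inv]
    have : birkhoffSum T φ (n + 1) (T (x n)) - birkhoffSum T φ (n + 1) (x n)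
        = φ (T^[n + 1] (x n)) - φ (x n) := birkhoffSum_apply_sub_birkhoffSum _ _ _ _
    have hb : ‖birkhoffSum T φ (n + 1) (T (x n)) - birkhoffSum T φ.toContinuousMap (n + 1) (x n)‖
        ≤ 2 * ‖φ‖ := by
      refine (congrArg norm this).trans_le ?_
      rw [← dist_eq_norm]
      exact φ.dist_le_two_norm _ _
    have hn : ‖(n : ℝ) + 1‖ = (n : ℝ) + 1 := Real.norm_of_nonneg (by positivity)
    rw [hn]
    gcongr
  refine (hg μ inferInstance hinv).not_ge (le_of_tendsto (hlim g) ?_)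
  filter_upwards [h𝒰p] with n hn
  exact mul_nonpos_of_nonneg_of_nonpos (by positivity) (hx n hn)

/-- If every invariant probability measure gives the integral `α` to some member of a countable
family of continuous functions, then one member has integral `α` against all of them. -/
theorem exists_forall_integral_eq_of_countable {ι : Type*} [Countable ι] (T : X ≃ₜ X)
    (F : ι → C(X, ℝ)) (α : ℝ)
    (hne : ∃ μ : Measure X, IsProbabilityMeasure μ ∧ Measure.map T μ = μ)
    (hα : ∀ μ : Measure X, IsProbabilityMeasure μ → Measure.map T μ = μ →
      ∃ i, ∫ x, F i x ∂μ = α) :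
    ∃ i, ∀ μ : Measure X, IsProbabilityMeasure μ → Measure.map T μ = μ →
      ∫ x, F i x ∂μ = α := by
  let K : Set (ProbabilityMeasure X) := {μ | μ.map T.continuous.aemeasurable = μ}
  have hK : IsClosed K :=
    isClosed_eq (ProbabilityMeasure.continuous_map T.continuous) continuous_id
  have hKiff : ∀ μ : ProbabilityMeasure X, μ ∈ K ↔ Measure.map T (μ : Measure X) = μ :=
    fun μ => Subtype.ext_iff
  have : CompactSpace K := isCompact_iff_compactSpace.mp hK.isCompact
  obtain ⟨μ₁, hμ₁, hinv₁⟩ := hne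
  have : Nonempty K := ⟨⟨⟨μ₁, hμ₁⟩, (hKiff _).mpr hinv₁⟩⟩
  have hcont : ∀ i, Continuous fun μ : K => ∫ x, F i x ∂((μ : ProbabilityMeasure X) : Measure X) :=
    fun i => (ProbabilityMeasure.continuous_integral_continuousMap (F i)).comp
      continuous_subtype_val
  obtain ⟨i, μ₀, hμ₀⟩ := nonempty_interior_of_iUnion_of_closed
    (f := fun i => {μ : K | ∫ x, F i x ∂((μ : ProbabilityMeasure X) : Measure X) = α})
    (fun i => isClosed_eq (hcont i) continuous_const)
    (eq_univ_of_forall fun μ => mem_iUnion.mpr (hα _ inferInstance ((hKiff _).mp μ.2)))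
  refine ⟨i, fun ν hν hinv => ?_⟩
  have hμ₀α := interior_subset hμ₀
  have hμ₀inv := (hKiff _).mp μ₀.2
  set μ : Measure X := ((μ₀ : ProbabilityMeasure X) : Measure X) with hμ
  let t : ℕ → ℝ := fun n => 1 / ((n : ℝ) + 1)
  have ht0 : ∀ n, 0 < t n := fun n => by positivity
  have ht1 : ∀ n, t n ≤ 1 := fun n => by
    simp only [t]
    rw [div_le_one (by positivity)]
    linarith [n.cast_nonneg (α := ℝ)]
  let P : ℕ → Measure X := fun n =>
    ENNReal.ofReal (1 - t n) • μ + ENNReal.ofReal (t n) • ν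
  have hP : ∀ n, IsProbabilityMeasure (P n) := fun n => ⟨by
    simp only [P, Measure.add_apply, Measure.smul_apply, measure_univ, smul_eq_mul, mul_one]
    rw [← ENNReal.ofReal_add (by linarith [ht1 n]) (ht0 n).le]
    simp⟩
  have hPinv : ∀ n, Measure.map T (P n) = P n := fun n => by
    simp only [P]
    rw [Measure.map_add _ _ T.continuous.measurable, Measure.map_smul, Measure.map_smul,
      hμ₀inv, hinv]
  have hPint : ∀ n (φ : C(X, ℝ)),
      ∫ x, φ x ∂(P n) = (1 - t n) * ∫ x, φ x ∂μ + t n * ∫ x, φ x ∂ν := fun n φ => by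
    simp only [P]
    rw [integral_add_measure
      ((φ.integrable_of_compactSpace μ).smul_measure ENNReal.ofReal_ne_top)
      ((φ.integrable_of_compactSpace ν).smul_measure ENNReal.ofReal_ne_top),
      integral_smul_measure, integral_smul_measure, ENNReal.toReal_ofReal (ht0 n).le,
      ENNReal.toReal_ofReal (by linarith [ht1 n])]
    simp
  let Q : ℕ → K := fun n => ⟨⟨P n, hP n⟩, (hKiff _).mpr (hPinv n)⟩
  have hQ : Tendsto Q atTop (𝓝 μ₀) := by
    rw [tendsto_subtype_rng, ProbabilityMeasure.tendsto_iff_forall_integral_tendsto]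
    intro φ
    have ht : Tendsto t atTop (𝓝 0) := tendsto_one_div_add_atTop_nhds_zero_nat
    have := ((ht.const_sub 1).mul_const (∫ x, φ x ∂μ)).add (ht.mul_const (∫ x, φ x ∂ν))
    simp only [sub_zero, one_mul, zero_mul, add_zero] at this
    exact this.congr fun n => (hPint n φ.toContinuousMap).symm
  obtain ⟨n, hn⟩ := (hQ.eventually (mem_interior_iff_mem_nhds.mp hμ₀)).exists
  have h1 : ∫ x, F i x ∂(P n) = α := hn
  have h2 : ∫ x, F i x ∂μ = α := hμ₀α
  rw [hPint, h2] at h1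
  have h3 : t n * (∫ x, F i x ∂ν - α) = 0 := by linarith
  rcases mul_eq_zero.mp h3 with h | h
  · exact absurd h (ht0 n).ne'
  · linarith

end InvariantMeasures

theorem ContinuousMap.countable_int {X : Type*} [TopologicalSpace X] [CompactSpace X]
    [TopologicalSpace.MetrizableSpace X] : Countable C(X, ℤ) := by
  have : DiscreteTopology C(X, ℤ) := by
    refine discreteTopology_iff_isOpen_singleton.mpr fun f => ?_
    have : {f} = Metric.ball f 1 := by
      ext g
      rw [mem_singleton_iff, Metric.mem_ball, ContinuousMap.dist_lt_iff one_pos]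
      refine ⟨fun h => by simp [h], fun h => ContinuousMap.ext fun x => ?_⟩
      have := h x
      rw [Int.dist_eq] at this
      have h' : |g x - f x| < 1 := by exact_mod_cast this
      rw [Int.abs_lt_one_iff] at h'
      omega
    rw [this]
    exact Metric.isOpen_ball
  exact TopologicalSpace.separableSpace_iff_countable.mp inferInstance

/-- If all long Birkhoff sums `S_n f` satisfy `0 ≤ S_n f ≤ n`, then `f` is cohomologous to a
function with values in `{0, 1}`. -/
theorem exists_coboundary_mem_Icc {X : Type*} [TopologicalSpace X] (T : X ≃ₜ X) (f : C(X, ℤ))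
    (N : ℕ) (hN : ∀ n, N ≤ n → ∀ x, 0 ≤ birkhoffSum T f n x ∧ birkhoffSum T f n x ≤ n) :
    ∃ g : C(X, ℤ), ∀ x, 0 ≤ f x + g (T x) - g x ∧ f x + g (T x) - g x ≤ 1 := by
  let R : Finset ℕ := Finset.range (N + 1)
  have hR : R.Nonempty := ⟨0, by simp [R]⟩
  let a : ℕ → X → ℤ := fun n x => birkhoffSum T f n x
  let b : ℕ → X → ℤ := fun n x => n - birkhoffSum T f n (T.symm^[n] x)
  have ha : ∀ n, Continuous (a n) := fun n =>
    continuous_finsetSum _ fun i _ => f.continuous.comp (T.continuous.iterate i)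
  have hb : ∀ n, Continuous (b n) := fun n =>
    continuous_const.sub ((ha n).comp (T.symm.continuous.iterate n))
  have ha0 : ∀ x, a 0 x = 0 := fun x => birkhoffSum_zero _ _ _
  have hb0 : ∀ x, b 0 x = 0 := fun x => by simp [b]
  have ha_succ : ∀ n x, a (n + 1) x = f x + a n (T x) := fun n x => birkhoffSum_succ' _ _ _ _
  have hb_succ : ∀ n x, b (n + 1) (T x) = 1 - f x + b n x := fun n x => by
    have h1 : T.symm^[n + 1] (T x) = T.symm^[n] x := by
      rw [Function.iterate_succ_apply, T.symm_apply_apply]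
    have h2 : T^[n] (T.symm^[n] x) = x :=
      (Function.LeftInverse.iterate T.apply_symm_apply n) x
    simp only [b]
    rw [h1, birkhoffSum_succ, h2]
    push_cast
    ring
  let g : C(X, ℤ) := ⟨fun x => R.inf' hR fun n => min (a n x) (b n x),
    Continuous.finset_inf'_apply hR fun n _ => (ha n).min (hb n)⟩
  have hg : ∀ x m, m ≤ g x ↔ ∀ n ∈ R, m ≤ a n x ∧ m ≤ b n x := fun x m => by
    simp [g, Finset.le_inf'_iff]
  have hg_le : ∀ x n, g x ≤ a n x ∧ g x ≤ b n x := fun x n => by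
    by_cases hn : n ∈ R
    · exact (hg x _).mp le_rfl n hn
    · have h0 := (hg x _).mp le_rfl 0 (by simp [R])
      rw [ha0, hb0] at h0
      have hn : N ≤ n := by simp [R] at hn; omega
      have h1 := (hN n hn x).1
      have h2 := (hN n hn (T.symm^[n] x)).2
      exact ⟨h0.1.trans h1, h0.2.trans (sub_nonneg.mpr h2)⟩
  have hg0 : ∀ x, g x ≤ 0 := fun x => (hg_le x 0).1.trans_eq (ha0 x)
  refine ⟨g, fun x => ⟨?_, ?_⟩⟩
  · suffices g x - f x ≤ g (T x) by linarith
    refine (hg _ _).mpr fun n _ => ?_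
    have h1 := (hg_le x (n + 1)).1
    rw [ha_succ] at h1
    refine ⟨by linarith, ?_⟩
    cases n with
    | zero => rw [hb0]; rw [ha0] at h1; linarith
    | succ k =>
      rw [hb_succ]
      linarith [(hg_le x k).2]
  · suffices g (T x) + f x - 1 ≤ g x by linarith
    refine (hg _ _).mpr fun n _ => ?_
    have h1 := (hg_le (T x) (n + 1)).2
    rw [hb_succ] at h1
    refine ⟨?_, by linarith⟩
    cases n with
    | zero => rw [ha0]; rw [hb0] at h1; linarith
    | succ k =>
      rw [ha_succ]
      linarith [(hg_le (T x) k).1]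

/-- If `(X,T)` is a minimal Cantor system and `α ∈ I(X,T)` with `0 < α < 1`,
then there is a clopen set `U ⊆ X` with `μ(U) = α` for every invariant probability
measure `μ`. -/
theorem stmt3 {X : Type*} [TopologicalSpace X] [CompactSpace X]
    [TopologicalSpace.MetrizableSpace X]
    [TotallyDisconnectedSpace X] [Nonempty X] [MeasurableSpace X] [BorelSpace X]
    (hni : ∀ x : X, ¬IsOpen ({x} : Set X))
    (T : X ≃ₜ X)
    (hmin : ∀ x : X, Dense (Set.range fun n : ℤ => (T.toEquiv ^ n) x))
    (α : ℝ) (h0 : 0 < α) (h1 : α < 1)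
    (hα : ∀ μ : Measure X, IsProbabilityMeasure μ → Measure.map T μ = μ →
      ∃ f : C(X, ℤ), ∫ x, (f x : ℝ) ∂μ = α) :
    ∃ U : Set X, IsClopen U ∧ ∀ μ : Measure X, IsProbabilityMeasure μ →
      Measure.map T μ = μ → μ U = ENNReal.ofReal α := by
  by_cases hne : ∃ μ : Measure X, IsProbabilityMeasure μ ∧ Measure.map T μ = μ
  swap
  · exact ⟨∅, isClopen_empty, fun μ hμ hinv => absurd ⟨μ, hμ, hinv⟩ hne⟩
  have : Countable C(X, ℤ) := ContinuousMap.countable_int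
  let F : C(X, ℤ) → C(X, ℝ) := fun f => ⟨fun x => (f x : ℝ), by fun_prop⟩
  obtain ⟨f, hf⟩ := exists_forall_integral_eq_of_countable T F α hne hα
  obtain ⟨N₁, hN₁⟩ := exists_forall_birkhoffSum_pos T (F f) fun μ hμ hinv => by
    rwa [hf μ hμ hinv]
  obtain ⟨N₂, hN₂⟩ := exists_forall_birkhoffSum_pos T (1 - F f) fun μ hμ hinv => by
    have : ∫ x, (1 - F f) x ∂μ = 1 - α := by
      rw [← hf μ hμ hinv]
      simp only [ContinuousMap.sub_apply, ContinuousMap.one_apply]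
      rw [integral_sub (integrable_const _) ((F f).integrable_of_compactSpace μ)]
      simp
    rw [this]
    linarith
  have hcast : ∀ n x, birkhoffSum T (F f) n x = (birkhoffSum T f n x : ℤ) := fun n x => by
    simp [birkhoffSum, F]
  obtain ⟨g, hg⟩ := exists_coboundary_mem_Icc T f (max N₁ N₂) fun n hn x => by
    have h1 := hN₁ n (by omega) x
    have h2 := hN₂ n (by omega) x
    have h3 : birkhoffSum T ⇑(1 - F f) n x = n - birkhoffSum T (F f) n x := by
      simp only [birkhoffSum, ContinuousMap.sub_apply, ContinuousMap.one_apply]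
      simp
    rw [h3, hcast] at h2
    rw [hcast] at h1
    constructor
    · exact_mod_cast h1.le
    · exact_mod_cast (sub_pos.mp h2).le
  let k : C(X, ℤ) := ⟨fun x => f x + g (T x) - g x, by fun_prop⟩
  have hU : IsClopen (k ⁻¹' {1}) := (isClopen_discrete {1}).preimage k.continuous
  refine ⟨k ⁻¹' {1}, hU, fun μ hμ hinv => ?_⟩
  have hgT : ∫ x, F g (T x) ∂μ = ∫ x, F g x ∂μ := by
    conv_rhs => rw [← hinv]
    exact (integral_map T.continuous.aemeasurable
      (F g).continuous.aestronglyMeasurable).symm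
  have hk : ∫ x, F k x ∂μ = α := by
    have : ∀ x, F k x = F f x + F g (T x) - F g x := fun x => by simp [F, k]
    simp only [this]
    have hi := ((F g).comp (T : C(X, X))).integrable_of_compactSpace μ
    have hsub := integral_sub (((F f).integrable_of_compactSpace μ).add hi)
      ((F g).integrable_of_compactSpace μ)
    have hadd := integral_add ((F f).integrable_of_compactSpace μ) hi
    simp only [Pi.add_apply, ContinuousMap.comp_apply, ContinuousMap.coe_coe] at hsub hadd
    rw [hsub, hadd, hgT, hf μ hμ hinv]
    ring
  have hind : ∀ x, F k x = (k ⁻¹' {1}).indicator (1 : X → ℝ) x := fun x => by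
    have h := hg x
    have h' : k x = 0 ∨ k x = 1 := by
      change f x + g (T x) - g x = 0 ∨ f x + g (T x) - g x = 1
      omega
    rcases h' with h' | h' <;> simp [F, indicator, h']
  simp only [hind] at hk
  rw [integral_indicator_one hU.isOpen.measurableSet] at hk
  rw [← hk, ofReal_measureReal]
end

section
/- Let (X,T) be a minimal Cantor system with a nested sequence of clopen Kakutani–Rohlin partitions satisfying (KR1)–(KR6). Let k be a nonzero integer and α ∈ ℝ be such that k·α belongs to E(X,T) but α does not belong to E(X,T). Then there exist an integer m > 1, a real vector v_m ∈ ℝ^{C_m} and an integer vector w_m ∈ ℤ^{C_m} such that: (1) k·α·P_m H_1 = w_m + v_m; (2) Σ_{n > m} ‖P_{n,m} v_m‖_∞ < ∞; (3) for every μ ∈ M(X,T) and every integer n ≥ m, ⟨μ_n, P_{n,m} v_m⟩ = 0, where μ_n = (μ(B_n(k')))_{k'=1}^{C_n}; (4) the vector (1/k)·P_{n,m} w_m is not an integer vector for infinitely many integers n > m. -/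
open MeasureTheory

/-- A nested sequence of clopen Kakutani–Rohlin partitions of a Cantor system `(X,T)`
satisfying (KR1)–(KR6), with the conventions `C 0 = 1`, `h 0 = 1`, `B 0 = X` and
`h 1 (k) = 1`.  The atoms of the `n`-th partition are the sets `T^j (B n k)` for
`0 ≤ j < h n k`. -/
structure KRSystem (X : Type*) [TopologicalSpace X] (T : X ≃ₜ X) where
  /-- number of towers at level `n` -/
  C : ℕ → ℕ
  C_pos : ∀ n, 0 < C n
  /-- bases of the towers -/
  B : (n : ℕ) → Fin (C n) → Set X
  /-- heights of the towers -/
  h : (n : ℕ) → Fin (C n) → ℕ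
  h_pos : ∀ n k, 0 < h n k
  clopen : ∀ n k, IsClopen (B n k)
  C_zero : C 0 = 1
  h_zero : ∀ k, h 0 k = 1
  B_zero : ∀ k, B 0 k = Set.univ
  h_one : ∀ k, h 1 k = 1
  /-- the atoms `T^j (B n k)`, `0 ≤ j < h n k`, are pairwise disjoint -/
  disj : ∀ n, ∀ k k' : Fin (C n), ∀ j j' : ℕ, j < h n k → j' < h n k' →
    (k ≠ k' ∨ j ≠ j') → Disjoint ((⇑T)^[j] '' B n k) ((⇑T)^[j'] '' B n k')
  /-- the atoms cover `X` -/
  cover : ∀ n, (⋃ (k : Fin (C n)) (j : ℕ) (_ : j < h n k), (⇑T)^[j] '' B n k) = Set.univ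
  /-- `⋃ k, T^{h n k} (B n k) = ⋃ k, B n k` -/
  ret : ∀ n, (⋃ k : Fin (C n), (⇑T)^[h n k] '' B n k) = ⋃ k : Fin (C n), B n k
  /-- (KR1) -/
  kr1 : ∀ n, (⋃ k : Fin (C (n + 1)), B (n + 1) k) ⊆ ⋃ k : Fin (C n), B n k
  /-- (KR2) the `(n+1)`-st partition refines the `n`-th one -/
  kr2 : ∀ n, ∀ l : Fin (C (n + 1)), ∀ j : ℕ, j < h (n + 1) l →
    ∃ k : Fin (C n), ∃ i : ℕ, i < h n k ∧ (⇑T)^[j] '' B (n + 1) l ⊆ (⇑T)^[i] '' B n k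
  /-- (KR3) the intersection of the bases is a single point -/
  kr3 : ∃ x : X, (⋂ n, ⋃ k : Fin (C n), B n k) = {x}
  /-- (KR4) the atoms span the topology of `X` -/
  kr4 : ∀ U : Set X, IsOpen U → ∀ x ∈ U, ∃ n, ∃ k : Fin (C n), ∃ j : ℕ,
    j < h n k ∧ x ∈ (⇑T)^[j] '' B n k ∧ (⇑T)^[j] '' B n k ⊆ U
  /-- (KR5) -/
  kr5 : ∀ n, ∀ k : Fin (C n), ∀ l : Fin (C (n + 1)), ∃ j : ℕ,
    j < h (n + 1) l ∧ (⇑T)^[j] '' B (n + 1) l ⊆ B n k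
  /-- (KR6) -/
  kr6 : ∀ n, (⋃ k : Fin (C (n + 1)), B (n + 1) k) ⊆ B n ⟨0, C_pos n⟩

variable {X : Type*} [TopologicalSpace X] {T : X ≃ₜ X}

/-- The incidence matrix between levels `n` and `n+1`; `KRM S n` corresponds to `M_{n+1}`
of the paper. -/
noncomputable def KRM (S : KRSystem X T) (n : ℕ) :
    Matrix (Fin (S.C (n + 1))) (Fin (S.C n)) ℤ := fun l k =>
  (Nat.card {j : ℕ // j < S.h (n + 1) l ∧ (⇑T)^[j] '' S.B (n + 1) l ⊆ S.B n k} : ℤ)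

/-- `KRP S m d` is the matrix `P_{m+d,m} = M_{m+d} ⋯ M_{m+1}` of the paper
(with `KRP S m 0 = 1`). -/
noncomputable def KRP (S : KRSystem X T) (m : ℕ) :
    (d : ℕ) → Matrix (Fin (S.C (m + d))) (Fin (S.C m)) ℤ
  | 0 => (1 : Matrix (Fin (S.C m)) (Fin (S.C m)) ℤ)
  | d + 1 => KRM S (m + d) * KRP S m d

/-- entrance time of `x` to the base of the `n`-th partition -/
noncomputable def KREntrance (S : KRSystem X T) (n : ℕ) (x : X) : ℕ :=
  sInf {j : ℕ | (⇑T)^[j] x ∈ ⋃ k : Fin (S.C n), S.B n k}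

/-- the suffix vector `s_n(x)` -/
noncomputable def KRSuffix (S : KRSystem X T) (n : ℕ) (x : X) (k : Fin (S.C n)) : ℕ :=
  Nat.card {j : ℕ // j < KREntrance S (n + 1) x ∧ (⇑T)^[j] x ∈ S.B n k}

namespace KRSystem

/-- The base of the `n`-th partition. -/
def base (S : KRSystem X T) (n : ℕ) : Set X := ⋃ k : Fin (S.C n), S.B n k

theorem mem_base (S : KRSystem X T) {n : ℕ} {k : Fin (S.C n)} {x : X} (hx : x ∈ S.B n k) :
    x ∈ S.base n :=
  Set.mem_iUnion.2 ⟨k, hx⟩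

theorem base_antitone (S : KRSystem X T) : Antitone S.base :=
  antitone_nat_of_succ_le S.kr1

theorem isClopen_base (S : KRSystem X T) (n : ℕ) : IsClopen (S.base n) :=
  isClopen_iUnion_of_finite (S.clopen n)

theorem eq_of_mem_atoms (S : KRSystem X T) {n : ℕ} {k k' : Fin (S.C n)} {j j' : ℕ} {x : X}
    (hj : j < S.h n k) (hj' : j' < S.h n k') (hx : x ∈ (⇑T)^[j] '' S.B n k)
    (hx' : x ∈ (⇑T)^[j'] '' S.B n k') : k = k' ∧ j = j' := by
  by_contra hne
  have hor : k ≠ k' ∨ j ≠ j' := by tauto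
  exact Set.disjoint_left.1 (S.disj n k k' j j' hj hj' hor) hx hx'

theorem exists_mem_atom (S : KRSystem X T) (n : ℕ) (x : X) :
    ∃ (k : Fin (S.C n)) (j : ℕ), j < S.h n k ∧ x ∈ (⇑T)^[j] '' S.B n k := by
  have hx : x ∈ (⋃ (k : Fin (S.C n)) (j : ℕ) (_ : j < S.h n k), (⇑T)^[j] '' S.B n k) := by
    rw [S.cover n]; trivial
  simpa only [Set.mem_iUnion, exists_prop] using hx

theorem nonempty_B [Nonempty X] (S : KRSystem X T) (n : ℕ) (k : Fin (S.C n)) :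
    (S.B n k).Nonempty := by
  obtain ⟨x⟩ := ‹Nonempty X›
  obtain ⟨l, j, -, y, hy, -⟩ := S.exists_mem_atom (n + 1) x
  obtain ⟨i, -, hi⟩ := S.kr5 n k l
  exact ⟨_, hi ⟨y, hy, rfl⟩⟩

theorem iterate_h_mem_base (S : KRSystem X T) {n : ℕ} {k : Fin (S.C n)} {x : X}
    (hx : x ∈ S.B n k) : (⇑T)^[S.h n k] x ∈ S.base n := by
  have h : (⇑T)^[S.h n k] x ∈ ⋃ k : Fin (S.C n), (⇑T)^[S.h n k] '' S.B n k :=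
    Set.mem_iUnion.2 ⟨k, x, hx, rfl⟩
  rwa [S.ret n] at h

theorem iterate_notMem_base (S : KRSystem X T) {n : ℕ} {k : Fin (S.C n)} {x : X}
    (hx : x ∈ S.B n k) {j : ℕ} (hj0 : 0 < j) (hj : j < S.h n k) :
    (⇑T)^[j] x ∉ S.base n := by
  intro hmem
  obtain ⟨k', hk'⟩ := Set.mem_iUnion.1 hmem
  have := (S.eq_of_mem_atoms hj (S.h_pos n k') ⟨x, hx, rfl⟩ ⟨_, hk', rfl⟩).2
  omega

/-- Summing a function of the tower type over the visits to the base of level `n` before a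
return time telescopes. -/
theorem sum_visits (S : KRSystem X T) (n : ℕ) (u : Fin (S.C n) → ℝ) (t : ℕ) :
    ∀ (Φ : ℕ → ℝ) (x : X), x ∈ S.base n → (⇑T)^[t] x ∈ S.base n →
      (∀ j k, (⇑T)^[j] x ∈ S.B n k → Φ (j + S.h n k) - Φ j = u k) →
      ∑ j ∈ Finset.range t, ∑ k, (S.B n k).indicator (fun _ => u k) ((⇑T)^[j] x) =
        Φ t - Φ 0 := by
  induction t using Nat.strong_induction_on with
  | _ t ih =>
    intro Φ x hx ht hΦ
    rcases Nat.eq_zero_or_pos t with rfl | htpos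
    · simp
    obtain ⟨k, hk⟩ := Set.mem_iUnion.1 hx
    have hle : S.h n k ≤ t := by
      by_contra hlt
      exact S.iterate_notMem_base hk htpos (by omega) ht
    have hpos := S.h_pos n k
    obtain ⟨s, rfl⟩ := Nat.exists_eq_add_of_le hle
    have key := ih s (by omega) (fun j => Φ (S.h n k + j)) ((⇑T)^[S.h n k] x)
      (S.iterate_h_mem_base hk)
      (by rwa [← Function.iterate_add_apply, Nat.add_comm])
      (by
        intro j k' hj
        rw [← Function.iterate_add_apply, Nat.add_comm] at hj
        simpa [Nat.add_assoc] using hΦ _ _ hj)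
    rw [Finset.sum_range_add]
    have h1 : ∑ j ∈ Finset.range (S.h n k),
        ∑ k', (S.B n k').indicator (fun _ => u k') ((⇑T)^[j] x) = u k := by
      rw [Finset.sum_eq_single_of_mem 0 (Finset.mem_range.2 hpos),
        Finset.sum_eq_single_of_mem k (Finset.mem_univ k)]
      · simp [hk]
      · intro k' _ hne
        refine Set.indicator_of_notMem (fun hmem => hne ?_) _
        exact (S.eq_of_mem_atoms (S.h_pos n k') hpos ⟨_, hmem, rfl⟩ ⟨_, hk, rfl⟩).1
      · intro j hj hj0
        refine Finset.sum_eq_zero fun k' _ => Set.indicator_of_notMem (fun hmem => ?_) _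
        exact S.iterate_notMem_base hk (Nat.pos_of_ne_zero hj0) (Finset.mem_range.1 hj)
          (S.mem_base hmem)
    have h2 := hΦ 0 k hk
    rw [h1, ← h2]
    simp only [← Function.iterate_add_apply, Nat.add_comm _ (S.h n k)] at key
    rw [key]
    simp

theorem image_subset_iff_mem (S : KRSystem X T) {n : ℕ} {l : Fin (S.C (n + 1))} {x : X}
    (hx : x ∈ S.B (n + 1) l) {j : ℕ} (hj : j < S.h (n + 1) l) (k : Fin (S.C n)) :
    (⇑T)^[j] '' S.B (n + 1) l ⊆ S.B n k ↔ (⇑T)^[j] x ∈ S.B n k := by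
  refine ⟨fun h => h ⟨x, hx, rfl⟩, fun h => ?_⟩
  obtain ⟨k', i, hi, hsub⟩ := S.kr2 n l j hj
  obtain ⟨rfl, rfl⟩ := S.eq_of_mem_atoms hi (S.h_pos n k) (hsub ⟨x, hx, rfl⟩) ⟨_, h, rfl⟩
  simpa using hsub

theorem KRM_mulVec_apply (S : KRSystem X T) {n : ℕ} (u : Fin (S.C n) → ℝ)
    {l : Fin (S.C (n + 1))} {x : X} (hx : x ∈ S.B (n + 1) l) (Φ : ℕ → ℝ)
    (hΦ : ∀ j k, (⇑T)^[j] x ∈ S.B n k → Φ (j + S.h n k) - Φ j = u k) :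
    ((KRM S n).map (Int.cast : ℤ → ℝ)).mulVec u l = Φ (S.h (n + 1) l) - Φ 0 := by
  classical
  rw [← S.sum_visits n u (S.h (n + 1) l) Φ x (S.base_antitone n.le_succ (S.mem_base hx))
    (S.base_antitone n.le_succ (S.iterate_h_mem_base hx)) hΦ, Finset.sum_comm]
  simp only [Matrix.mulVec, dotProduct]
  refine Finset.sum_congr rfl fun k _ => ?_
  have hcard : Nat.card {j : ℕ // j < S.h (n + 1) l ∧ (⇑T)^[j] '' S.B (n + 1) l ⊆ S.B n k} =
      ((Finset.range (S.h (n + 1) l)).filter fun j => (⇑T)^[j] x ∈ S.B n k).card := by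
    rw [← Nat.card_eq_finsetCard]
    refine Nat.card_congr (Equiv.subtypeEquivRight fun j => ?_)
    rw [Finset.mem_filter, Finset.mem_range]
    exact and_congr_right fun hj => S.image_subset_iff_mem hx hj k
  simp only [Set.indicator_apply, Matrix.map_apply, KRM, hcard]
  rw [← Finset.sum_filter, Finset.sum_const, nsmul_eq_mul]
  simp

theorem image_iterate_eq_preimage (T : X ≃ₜ X) (j : ℕ) (A : Set X) :
    (⇑T)^[j] '' A = (⇑T.symm)^[j] ⁻¹' A :=
  congrFun (Set.image_eq_preimage_of_inverse
    (Function.LeftInverse.iterate T.symm_apply_apply j)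
    (Function.LeftInverse.iterate T.apply_symm_apply j)) A

theorem isOpen_image_iterate (T : X ≃ₜ X) {A : Set X} (hA : IsOpen A) (j : ℕ) :
    IsOpen ((⇑T)^[j] '' A) := by
  rw [image_iterate_eq_preimage]
  exact hA.preimage (T.symm.continuous.iterate j)

/-- Every point lies over a unique point of the base, at a unique height. -/
theorem exists_coordinates (S : KRSystem X T) (n : ℕ) :
    ∃ (L : X → Fin (S.C n)) (J : X → ℕ) (b : X → X),
      Continuous J ∧ Continuous b ∧
      (∀ x, J x < S.h n (L x) ∧ b x ∈ S.B n (L x) ∧ (⇑T)^[J x] (b x) = x) ∧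
      (∀ y l j, y ∈ S.B n l → j < S.h n l →
        L ((⇑T)^[j] y) = l ∧ J ((⇑T)^[j] y) = j ∧ b ((⇑T)^[j] y) = y) := by
  choose L J hJ b hb hTb using S.exists_mem_atom n
  have huniq : ∀ y l j, y ∈ S.B n l → j < S.h n l →
      L ((⇑T)^[j] y) = l ∧ J ((⇑T)^[j] y) = j ∧ b ((⇑T)^[j] y) = y := by
    intro y l j hy hj
    obtain ⟨h1, h2⟩ := S.eq_of_mem_atoms (hJ ((⇑T)^[j] y)) hj ⟨_, hb _, hTb _⟩ ⟨y, hy, rfl⟩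
    refine ⟨h1, h2, ?_⟩
    have h3 := hTb ((⇑T)^[j] y)
    rw [h2] at h3
    exact T.injective.iterate j h3
  have hnhds : ∀ x, ∀ᶠ z in nhds x, z ∈ (⇑T)^[J x] '' S.B n (L x) := by
    intro x
    exact (isOpen_image_iterate T (S.clopen n (L x)).isOpen (J x)).mem_nhds ⟨_, hb x, hTb x⟩
  refine ⟨L, J, b, ?_, ?_, fun x => ⟨hJ x, hb x, hTb x⟩, huniq⟩
  · rw [continuous_iff_continuousAt]
    intro x
    refine (continuousAt_const (y := J x)).congr ?_
    filter_upwards [hnhds x] with z hz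
    obtain ⟨y, hy, rfl⟩ := hz
    exact (huniq y _ _ hy (hJ x)).2.1.symm
  · rw [continuous_iff_continuousAt]
    intro x
    refine ((T.symm.continuous.iterate (J x)).continuousAt).congr ?_
    filter_upwards [hnhds x] with z hz
    obtain ⟨y, hy, rfl⟩ := hz
    rw [(huniq y _ _ hy (hJ x)).2.2]
    exact (Function.LeftInverse.iterate T.symm_apply_apply (J x)) y

theorem exists_base_subset [CompactSpace X] (S : KRSystem X T) {x₀ : X}
    (hx₀ : (⋂ n, S.base n) = {x₀}) {U : Set X} (hU : U ∈ nhds x₀) :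
    ∃ m, 1 < m ∧ S.base m ⊆ U := by
  obtain ⟨m, hm⟩ := exists_subset_nhds_of_isCompact' (V := S.base)
    (directed_of_isDirected_le fun i j hij => S.base_antitone hij)
    (fun n => (S.isClopen_base n).isClosed.isCompact)
    (fun n => (S.isClopen_base n).isClosed) (U := U)
    (by intro x hx; rw [hx₀, Set.mem_singleton_iff] at hx; rwa [hx])
  exact ⟨max m 2, by omega, (S.base_antitone (le_max_left m 2)).trans hm⟩

/-- `g` is a real logarithm, divided by `2πi`, of an eigenfunction with eigenvalue `β`. -/
def IsLog (T : X ≃ₜ X) (β : ℝ) (g : X → ℝ) : Prop :=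
  ∀ x (p : ℕ), ∃ z : ℤ, β * p = z + (g ((⇑T)^[p] x) - g x)

theorem int_eq_of_abs_sub_lt {z z' : ℤ} {a b c : ℝ} (h : c = z + a) (h' : c = z' + b)
    (hab : |a - b| < 1) : z = z' ∧ a = b := by
  have hz : z = z' := by
    have h1 : |((z - z' : ℤ) : ℝ)| < 1 := by
      push_cast
      rwa [show (z : ℝ) - z' = -(a - b) by linarith, abs_neg]
    have h2 : |z - z'| < 1 := by exact_mod_cast h1
    have := Int.abs_lt_one_iff.1 h2
    omega
  subst hz
  exact ⟨rfl, by linarith⟩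

/-- Increments of a small logarithm over the same time are equal. -/
theorem IsLog.increment_eq {β : ℝ} {g : X → ℝ} (hg : IsLog T β g) {A : Set X}
    (hA : ∀ x ∈ A, |g x| < 1 / 8) {x y : X} {p : ℕ} (hx : x ∈ A) (hy : y ∈ A)
    (hpx : (⇑T)^[p] x ∈ A) (hpy : (⇑T)^[p] y ∈ A) :
    g ((⇑T)^[p] x) - g x = g ((⇑T)^[p] y) - g y := by
  obtain ⟨z, hz⟩ := hg x p
  obtain ⟨z', hz'⟩ := hg y p
  refine (int_eq_of_abs_sub_lt hz hz' ?_).2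
  have h1 := abs_lt.1 (hA _ hx)
  have h2 := abs_lt.1 (hA _ hy)
  have h3 := abs_lt.1 (hA _ hpx)
  have h4 := abs_lt.1 (hA _ hpy)
  rw [abs_lt]
  constructor <;> linarith

theorem IsLog.exists_decomposition [Nonempty X] (S : KRSystem X T) {β : ℝ} {g : X → ℝ}
    (hg : IsLog T β g) {m : ℕ} (hm : ∀ x ∈ S.base m, |g x| < 1 / 8) :
    ∃ (V : (n : ℕ) → Fin (S.C n) → ℝ) (W : (n : ℕ) → Fin (S.C n) → ℤ),
      (∀ n l, β * S.h n l = W n l + V n l) ∧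
      (∀ n, m ≤ n → ∀ l, ∀ x ∈ S.B n l, g ((⇑T)^[S.h n l] x) - g x = V n l) := by
  choose x hx using S.nonempty_B
  choose z hz using id hg
  refine ⟨fun n l => g ((⇑T)^[S.h n l] (x n l)) - g (x n l), fun n l => z (x n l) (S.h n l),
    fun n l => hz _ _, fun n hn l y hy => ?_⟩
  have hsub := S.base_antitone hn
  exact hg.increment_eq hm (hsub (S.mem_base hy)) (hsub (S.mem_base (hx n l)))
    (hsub (S.iterate_h_mem_base hy)) (hsub (S.iterate_h_mem_base (hx n l)))

/-- Two points of the base of level `n` seeing `V n l` as an increment of `g` on top of the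
difference of `g` at two given points of the base of level `n + 2`. -/
theorem exists_difference_eq (S : KRSystem X T) {β : ℝ} {g : X → ℝ}
    (hg : IsLog T β g) {n : ℕ} (hn : ∀ x ∈ S.base n, |g x| < 1 / 8) {V : Fin (S.C n) → ℝ}
    (hV : ∀ l, ∀ x ∈ S.B n l, g ((⇑T)^[S.h n l] x) - g x = V l) (l : Fin (S.C n))
    {y y' : X} (hy : y ∈ S.base (n + 2)) (hy' : y' ∈ S.base (n + 2)) :
    ∃ z ∈ S.base n, ∃ z' ∈ S.base n, g z - g z' = g y - g y' + |V l| := by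
  obtain ⟨p, -, hp⟩ := S.kr5 n l ⟨0, S.C_pos (n + 1)⟩
  have h1 := S.kr6 (n + 1) hy
  have h1' := S.kr6 (n + 1) hy'
  have h2 : (⇑T)^[p] y ∈ S.B n l := hp ⟨y, h1, rfl⟩
  have h2' : (⇑T)^[p] y' ∈ S.B n l := hp ⟨y', h1', rfl⟩
  have hsub := S.base_antitone (show n ≤ n + 2 by omega)
  have h3 := hg.increment_eq hn (hsub hy) (hsub hy') (S.mem_base h2) (S.mem_base h2')
  have h4 := hV l _ h2
  have h4' := hV l _ h2'
  rcases abs_cases (V l) with ⟨h, -⟩ | ⟨h, -⟩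
  · exact ⟨_, S.iterate_h_mem_base h2, _, S.mem_base h2', by linarith⟩
  · exact ⟨_, S.mem_base h2, _, S.iterate_h_mem_base h2', by linarith⟩

theorem sum_norm_alternate_le (S : KRSystem X T) {β : ℝ} {g : X → ℝ}
    (hg : IsLog T β g) {n : ℕ} (hn : ∀ x ∈ S.base n, |g x| < 1 / 8)
    {V : (n : ℕ) → Fin (S.C n) → ℝ}
    (hV : ∀ i, n ≤ i → ∀ l, ∀ x ∈ S.B i l, g ((⇑T)^[S.h i l] x) - g x = V i l) (N : ℕ) :
    ∀ y ∈ S.base (n + 2 * N), ∀ y' ∈ S.base (n + 2 * N),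
      g y - g y' + ∑ i ∈ Finset.range N, ‖V (n + 2 * i)‖ ≤ 1 / 4 := by
  induction N with
  | zero =>
    intro y hy y' hy'
    have h1 := abs_lt.1 (hn y hy)
    have h2 := abs_lt.1 (hn y' hy')
    simp only [Finset.range_zero, Finset.sum_empty]
    linarith
  | succ N ih =>
    intro y hy y' hy'
    have hne : Nonempty (Fin (S.C (n + 2 * N))) := ⟨⟨0, S.C_pos _⟩⟩
    have hle : ‖V (n + 2 * N)‖ ≤
        1 / 4 - (g y - g y') - ∑ i ∈ Finset.range N, ‖V (n + 2 * i)‖ := by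
      rw [pi_norm_le_iff_of_nonempty]
      intro l
      obtain ⟨z, hz, z', hz', h⟩ := S.exists_difference_eq hg
        (fun x hx => hn x (S.base_antitone (by omega) hx)) (hV (n + 2 * N) (by omega)) l hy hy'
      have := ih z hz z' hz'
      rw [Real.norm_eq_abs]
      linarith
    rw [Finset.sum_range_succ]
    linarith

theorem summable_norm_alternate [Nonempty X] (S : KRSystem X T) {β : ℝ} {g : X → ℝ}
    (hg : IsLog T β g) {n : ℕ} (hn : ∀ x ∈ S.base n, |g x| < 1 / 8)
    {V : (n : ℕ) → Fin (S.C n) → ℝ}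
    (hV : ∀ i, n ≤ i → ∀ l, ∀ x ∈ S.B i l, g ((⇑T)^[S.h i l] x) - g x = V i l) :
    Summable fun i => ‖V (n + 2 * i)‖ := by
  refine summable_of_sum_range_le (c := 1 / 4) (fun _ => norm_nonneg _) fun N => ?_
  obtain ⟨y, hy⟩ := S.nonempty_B (n + 2 * N) ⟨0, S.C_pos _⟩
  simpa using S.sum_norm_alternate_le hg hn hV N y (S.mem_base hy) y (S.mem_base hy)

theorem summable_norm [Nonempty X] (S : KRSystem X T) {β : ℝ} {g : X → ℝ}
    (hg : IsLog T β g) {m : ℕ} (hm : ∀ x ∈ S.base m, |g x| < 1 / 8)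
    {V : (n : ℕ) → Fin (S.C n) → ℝ}
    (hV : ∀ n, m ≤ n → ∀ l, ∀ x ∈ S.B n l, g ((⇑T)^[S.h n l] x) - g x = V n l) :
    Summable fun d => ‖V (m + (d + 1))‖ := by
  have key : ∀ i, Summable fun d => ‖V (m + i + 2 * d)‖ := fun i =>
    S.summable_norm_alternate hg
      (fun x hx => hm x (S.base_antitone (by omega) hx)) fun n hn => hV n (by omega)
  have hadd : ∀ a b c : ℕ, a = b + c → ‖V (b + c)‖ = ‖V a‖ := by
    rintro a b c rfl; rfl
  refine (HasSum.even_add_odd (f := fun d => ‖V (m + (d + 1))‖)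
    (m := ∑' d, ‖V (m + 1 + 2 * d)‖) (m' := ∑' d, ‖V (m + 2 + 2 * d)‖) ?_ ?_).summable
  · convert (key 1).hasSum using 2 with d
    exact hadd _ _ _ (by ring)
  · convert (key 2).hasSum using 2 with d
    exact hadd _ _ _ (by ring)

theorem KRP_mulVec (S : KRSystem X T) {m : ℕ} {V : (n : ℕ) → Fin (S.C n) → ℝ}
    (hV : ∀ n, m ≤ n → ((KRM S n).map (Int.cast : ℤ → ℝ)).mulVec (V n) = V (n + 1)) (d : ℕ) :
    ((KRP S m d).map (Int.cast : ℤ → ℝ)).mulVec (V m) = V (m + d) := by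
  induction d with
  | zero =>
    have h1 : (KRP S m 0).map (Int.cast : ℤ → ℝ) = 1 :=
      Matrix.map_one _ Int.cast_zero Int.cast_one
    rw [h1]
    exact Matrix.one_mulVec _
  | succ d ih =>
    have h1 : (KRM S (m + d) * KRP S m d).map (Int.cast : ℤ → ℝ) =
        (KRM S (m + d)).map (Int.cast : ℤ → ℝ) * (KRP S m d).map (Int.cast : ℤ → ℝ) :=
      Matrix.map_mul (f := Int.castRingHom ℝ)
    change ((KRM S (m + d) * KRP S m d).map (Int.cast : ℤ → ℝ)).mulVec (V m) = V (m + d + 1)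
    rw [h1, ← Matrix.mulVec_mulVec, ih]
    exact hV _ (by omega)

theorem KRM_mulVec_of_increment [Nonempty X] (S : KRSystem X T) {m : ℕ} {g : X → ℝ}
    {V : (n : ℕ) → Fin (S.C n) → ℝ}
    (hV : ∀ n, m ≤ n → ∀ l, ∀ x ∈ S.B n l, g ((⇑T)^[S.h n l] x) - g x = V n l) {n : ℕ}
    (hn : m ≤ n) : ((KRM S n).map (Int.cast : ℤ → ℝ)).mulVec (V n) = V (n + 1) := by
  funext l
  obtain ⟨x, hx⟩ := S.nonempty_B (n + 1) l
  rw [S.KRM_mulVec_apply (V n) hx (fun j => g ((⇑T)^[j] x)), ← hV (n + 1) (by omega) l x hx]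
  · simp
  · intro j k hj
    rw [← hV n hn k _ hj, ← Function.iterate_add_apply, Nat.add_comm]

theorem KRM_mulVec_height [Nonempty X] (S : KRSystem X T) (β : ℝ) (n : ℕ) :
    ((KRM S n).map (Int.cast : ℤ → ℝ)).mulVec (fun l => β * S.h n l) =
      fun l => β * S.h (n + 1) l := by
  funext l
  obtain ⟨x, hx⟩ := S.nonempty_B (n + 1) l
  rw [S.KRM_mulVec_apply _ hx (fun j => β * j)]
  · simp
  · intro j k _
    push_cast
    ring

theorem KRP_mulVec_int (S : KRSystem X T) [Nonempty X] {m : ℕ} {β : ℝ}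
    {V : (n : ℕ) → Fin (S.C n) → ℝ} {W : (n : ℕ) → Fin (S.C n) → ℤ}
    (hW : ∀ n l, β * S.h n l = W n l + V n l)
    (hV : ∀ n, m ≤ n → ((KRM S n).map (Int.cast : ℤ → ℝ)).mulVec (V n) = V (n + 1)) (d : ℕ) :
    (KRP S m d).mulVec (W m) = W (m + d) := by
  have hWV : ∀ n, (fun l => (W n l : ℝ)) = (fun l => β * S.h n l) - V n := by
    intro n
    funext l
    simp [hW n l]
  have h := S.KRP_mulVec (m := m) (V := fun n l => (W n l : ℝ)) (fun n hn => by
    simp only [hWV]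
    rw [Matrix.mulVec_sub, S.KRM_mulVec_height, hV n hn]) d
  funext l
  have hl := congrFun h l
  rw [← Int.cast_inj (α := ℝ), ← hl]
  simp [Matrix.mulVec, dotProduct]

/-- The induced increments of a function continuous on the base integrate to zero. -/
theorem sum_measure_mul_eq_zero [CompactSpace X] [MeasurableSpace X] [BorelSpace X]
    (S : KRSystem X T) {n : ℕ} {g : X → ℝ} (hgc : ContinuousOn g (S.base n))
    {V : Fin (S.C n) → ℝ} (hV : ∀ l, ∀ x ∈ S.B n l, g ((⇑T)^[S.h n l] x) - g x = V l)
    (μ : Measure X) [IsProbabilityMeasure μ] (hμ : Measure.map T μ = μ) :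
    ∑ l, (μ (S.B n l)).toReal * V l = 0 := by
  obtain ⟨L, J, b, -, hb, hx, huniq⟩ := S.exists_coordinates n
  have hgb : Continuous fun x => g (b x) :=
    hgc.comp_continuous hb fun x => S.mem_base (hx x).2.1
  have hmp : MeasurePreserving T μ μ := ⟨T.continuous.measurable, hμ⟩
  have hint : Integrable (fun x => g (b x)) μ :=
    hgb.integrable_of_hasCompactSupport (HasCompactSupport.of_compactSpace _)
  have hint' : Integrable (fun x => g (b (T x))) μ :=
    (hgb.comp T.continuous).integrable_of_hasCompactSupport (HasCompactSupport.of_compactSpace _)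
  have hmeas : ∀ l j, MeasurableSet ((⇑T)^[j] '' S.B n l) := fun l j =>
    (isOpen_image_iterate T (S.clopen n l).isOpen j).measurableSet
  have hμB : ∀ l j, μ ((⇑T)^[j] '' S.B n l) = μ (S.B n l) := by
    intro l j
    rw [← (hmp.iterate j).measure_preimage (hmeas l j).nullMeasurableSet,
      Set.preimage_image_eq _ (T.injective.iterate j)]
  have hcob : ∀ x, g (b (T x)) - g (b x) =
      ∑ l, ((⇑T)^[S.h n l - 1] '' S.B n l).indicator (fun _ => V l) x := by
    intro x
    obtain ⟨hJ, hB, hT⟩ := hx x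
    have hTx : T x = (⇑T)^[J x + 1] (b x) := by rw [Function.iterate_succ_apply', hT]
    have hmem : ∀ l, x ∈ (⇑T)^[S.h n l - 1] '' S.B n l → L x = l ∧ J x = S.h n l - 1 := by
      rintro l ⟨y, hy, rfl⟩
      have := huniq y l (S.h n l - 1) hy (Nat.sub_lt (S.h_pos n l) one_pos)
      exact ⟨this.1, this.2.1⟩
    by_cases hlast : J x + 1 = S.h n (L x)
    · rw [Finset.sum_eq_single_of_mem (L x) (Finset.mem_univ _)
        fun l _ hl => Set.indicator_of_notMem (fun h => hl (hmem l h).1.symm) _,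
        Set.indicator_of_mem (show x ∈ (⇑T)^[S.h n (L x) - 1] '' S.B n (L x) from
          ⟨b x, hB, by rw [← hlast]; simpa using hT⟩)]
      have hret : T x ∈ S.base n := by
        rw [hTx, hlast]
        exact S.iterate_h_mem_base hB
      obtain ⟨l', hl'⟩ := Set.mem_iUnion.1 hret
      have hbT : b (T x) = T x := (huniq _ l' 0 hl' (S.h_pos n l')).2.2
      rw [hbT, hTx, hlast]
      exact hV _ _ hB
    · rw [Finset.sum_eq_zero, hTx, (huniq _ _ (J x + 1) hB (by omega)).2.2, sub_self]
      refine fun l _ => Set.indicator_of_notMem (fun h => ?_) _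
      obtain ⟨rfl, h2⟩ := hmem l h
      omega
  have hzero : ∫ x, (g (b (T x)) - g (b x)) ∂μ = 0 := by
    rw [integral_sub hint' hint, sub_eq_zero]
    exact hmp.integral_comp T.measurableEmbedding fun x => g (b x)
  simp only [hcob] at hzero
  rw [integral_finsetSum _ fun l _ => (integrable_const (V l)).indicator (hmeas l _)] at hzero
  rw [← hzero]
  refine Finset.sum_congr rfl fun l _ => ?_
  rw [integral_indicator_const _ (hmeas l _), smul_eq_mul, measureReal_def, hμB]

/-- If the integer parts of `kα` times the heights are all divisible by `k`, the eigenfunction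
for `kα` has a `k`-th root which is an eigenfunction for `α`. -/
theorem exists_eigenfunction_of_dvd [Nonempty X] (S : KRSystem X T) {n : ℕ} {g : X → ℝ}
    (hgc : ContinuousOn g (S.base n)) {k : ℤ} (hk : k ≠ 0) {α : ℝ}
    {V : Fin (S.C n) → ℝ} {W : Fin (S.C n) → ℤ}
    (hV : ∀ l, ∀ x ∈ S.B n l, g ((⇑T)^[S.h n l] x) - g x = V l)
    (hW : ∀ l, (k : ℝ) * α * S.h n l = W l + V l) (hdvd : ∀ l, k ∣ W l) :
    ∃ f : C(X, ℂ), f ≠ 0 ∧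
      ∀ x : X, f (T x) = Complex.exp (2 * Real.pi * Complex.I * α) * f x := by
  obtain ⟨L, J, b, hJc, hb, hx, huniq⟩ := S.exists_coordinates n
  have hgb : Continuous fun x => g (b x) :=
    hgc.comp_continuous hb fun x => S.mem_base (hx x).2.1
  have hJc' : Continuous fun x => (J x : ℝ) := continuous_of_discreteTopology.comp hJc
  set θ : X → ℝ := fun x => α * J x + g (b x) / k with hθ
  have hθc : Continuous θ := (hJc'.const_mul α).add (hgb.div_const _)
  refine ⟨⟨fun x => Complex.exp (2 * Real.pi * Complex.I * θ x), by fun_prop⟩, ?_, fun x => ?_⟩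
  · obtain ⟨x⟩ := ‹Nonempty X›
    exact fun h => Complex.exp_ne_zero _ (DFunLike.congr_fun h x)
  obtain ⟨hJ, hB, hT⟩ := hx x
  have hTx : T x = (⇑T)^[J x + 1] (b x) := by rw [Function.iterate_succ_apply', hT]
  have hstep : ∃ z : ℤ, α + θ x = θ (T x) + z := by
    by_cases hlast : J x + 1 = S.h n (L x)
    · have hret : T x ∈ S.base n := by
        rw [hTx, hlast]
        exact S.iterate_h_mem_base hB
      obtain ⟨l', hl'⟩ := Set.mem_iUnion.1 hret
      obtain ⟨-, hJT, hbT⟩ : _ ∧ J (T x) = 0 ∧ b (T x) = T x :=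
        huniq _ l' 0 hl' (S.h_pos n l')
      obtain ⟨z, hz⟩ := hdvd (L x)
      refine ⟨z, ?_⟩
      have h1 := hV _ _ hB
      have h2 := hW (L x)
      rw [← hlast, ← hTx] at h1
      rw [← hlast, hz, ← h1] at h2
      push_cast at h2
      have hk' : (k : ℝ) ≠ 0 := by exact_mod_cast hk
      simp only [hθ, hJT, hbT]
      field_simp
      push_cast
      linarith
    · obtain ⟨-, hJT, hbT⟩ := huniq _ _ (J x + 1) hB (by omega)
      rw [← hTx] at hJT hbT
      refine ⟨0, ?_⟩
      simp only [hθ, hJT, hbT]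
      push_cast
      ring
  obtain ⟨z, hz⟩ := hstep
  have hz' : (α : ℂ) + θ x = θ (T x) + z := by exact_mod_cast hz
  simp only [ContinuousMap.coe_mk]
  rw [← Complex.exp_add, ← mul_add, hz', Complex.exp_eq_exp_iff_exists_int]
  exact ⟨-z, by push_cast; ring⟩

end KRSystem

theorem eigenfunction_iterate {T : X ≃ₜ X} {f : X → ℂ} {c : ℂ} (hf : ∀ x, f (T x) = c * f x)
    (p : ℕ) (x : X) : f ((⇑T)^[p] x) = c ^ p * f x := by
  induction p with
  | zero => simp
  | succ p ih => rw [Function.iterate_succ_apply', hf, ih]; ring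

theorem eigenfunction_ne_zero {T : X ≃ₜ X}
    (hmin : ∀ x : X, Dense (Set.range fun n : ℤ => (T.toEquiv ^ n) x))
    {f : C(X, ℂ)} (hf0 : f ≠ 0) {c : ℂ} (hc : c ≠ 0) (hf : ∀ x, f (T x) = c * f x) (x : X) :
    f x ≠ 0 := by
  intro hx
  have hinv : ∀ y, f (T y) = 0 ↔ f y = 0 := fun y => by simp [hf, hc]
  have horb : ∀ n : ℤ, f ((T.toEquiv ^ n) x) = 0 := by
    intro n
    induction n using Int.induction_on with
    | zero => simpa using hx
    | succ n ih =>
      rw [add_comm, zpow_add, zpow_one, Equiv.Perm.mul_apply]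
      exact (hinv _).2 ih
    | pred n ih =>
      have h : (T.toEquiv ^ (-(n : ℤ))) x = T ((T.toEquiv ^ (-(n : ℤ) - 1)) x) := by
        rw [show -(n : ℤ) = 1 + (-(n : ℤ) - 1) by ring, zpow_add, zpow_one,
          Equiv.Perm.mul_apply]
        simp
      rw [h] at ih
      exact (hinv _).1 ih
  refine hf0 (ContinuousMap.ext fun y => ?_)
  refine congrFun (Continuous.ext_on (f := f) (g := fun _ => (0 : ℂ)) (hmin x) f.continuous
    continuous_const ?_) y
  rintro _ ⟨n, rfl⟩
  exact horb n

open Complex in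
theorem isLog_arg {T : X ≃ₜ X} {β : ℝ} {f : X → ℂ}
    (hf : ∀ x, f (T x) = Complex.exp (2 * Real.pi * Complex.I * β) * f x)
    (hf0 : ∀ x, f x ≠ 0) : KRSystem.IsLog T β fun x => (f x).arg / (2 * Real.pi) := by
  intro x p
  have h := eigenfunction_iterate hf p x
  have harg : ((f ((⇑T)^[p] x)).arg : Real.Angle) = ((2 * Real.pi * β * p + (f x).arg : ℝ)) := by
    rw [h, Complex.arg_mul_coe_angle (pow_ne_zero _ (exp_ne_zero _)) (hf0 x), ← Complex.exp_nat_mul,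
      Real.Angle.coe_add,
      show (p : ℂ) * (2 * Real.pi * I * β) = ((2 * Real.pi * β * p : ℝ) : ℂ) * I by
        push_cast; ring, Complex.arg_exp_mul_I, Real.Angle.coe_toIocMod]
  obtain ⟨z, hz⟩ := Real.Angle.angle_eq_iff_two_pi_dvd_sub.1 harg
  refine ⟨-z, ?_⟩
  have hpi := Real.pi_ne_zero
  push_cast
  field_simp
  linarith

/-- Let `(X,T)` be a minimal Cantor system with a nested sequence of CKR
partitions satisfying (KR1)–(KR6).  If `k ≠ 0` is an integer such that `k·α ∈ E(X,T)` but
`α ∉ E(X,T)`, then there are `m > 1`, `v_m ∈ ℝ^{C_m}`, `w_m ∈ ℤ^{C_m}` with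
(1) `k·α·P_m H_1 = w_m + v_m` (recall `P_m H_1 = H_m`);
(2) `Σ_{n>m} ‖P_{n,m} v_m‖_∞ < ∞`;
(3) `⟨μ_n, P_{n,m} v_m⟩ = 0` for every invariant probability measure `μ` and `n ≥ m`;
(4) `(1/k)·P_{n,m} w_m` is not an integer vector for infinitely many `n > m`. -/
theorem stmt9 {X : Type*} [TopologicalSpace X] [CompactSpace X]
    [TopologicalSpace.MetrizableSpace X] [TotallyDisconnectedSpace X] [Nonempty X]
    [MeasurableSpace X] [BorelSpace X]
    (hni : ∀ x : X, ¬IsOpen ({x} : Set X))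
    (T : X ≃ₜ X)
    (hmin : ∀ x : X, Dense (Set.range fun n : ℤ => (T.toEquiv ^ n) x))
    (S : KRSystem X T)
    (k : ℤ) (hk : k ≠ 0) (α : ℝ)
    (hkα : ∃ f : C(X, ℂ), f ≠ 0 ∧
      ∀ x : X, f (T x) = Complex.exp (2 * Real.pi * Complex.I * ((k : ℝ) * α)) * f x)
    (hα : ¬ ∃ f : C(X, ℂ), f ≠ 0 ∧
      ∀ x : X, f (T x) = Complex.exp (2 * Real.pi * Complex.I * α) * f x) :
    ∃ (m : ℕ), 1 < m ∧ ∃ (v : Fin (S.C m) → ℝ) (w : Fin (S.C m) → ℤ),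
      (∀ l : Fin (S.C m), (k : ℝ) * α * (S.h m l : ℝ) = (w l : ℝ) + v l) ∧
      (Summable fun d : ℕ =>
        ‖((KRP S m (d + 1)).map (Int.cast : ℤ → ℝ)).mulVec v‖) ∧
      (∀ μ : Measure X, IsProbabilityMeasure μ → Measure.map T μ = μ →
        ∀ d : ℕ, (∑ l : Fin (S.C (m + d)),
          (μ (S.B (m + d) l)).toReal *
            (((KRP S m d).map (Int.cast : ℤ → ℝ)).mulVec v) l) = 0) ∧
      (∀ N : ℕ, ∃ d : ℕ, N < d ∧
        ¬ ∀ l : Fin (S.C (m + d)), k ∣ ((KRP S m d).mulVec w) l) := by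
  obtain ⟨f, hf0, hf⟩ := hkα
  obtain ⟨x₀, hx₀⟩ := S.kr3
  have hf' : ∀ x, f (T x) =
      Complex.exp (2 * Real.pi * Complex.I * ((k * α : ℝ) : ℂ)) * f x := by
    intro x
    rw [hf]
    push_cast
    rfl
  have hne := eigenfunction_ne_zero hmin hf0 (Complex.exp_ne_zero _) hf'
  set g : X → ℝ := fun x => (f x / f x₀).arg / (2 * Real.pi) with hgdef
  have hg : KRSystem.IsLog T (k * α) g :=
    isLog_arg (f := fun x => f x / f x₀) (fun x => by rw [hf', mul_div_assoc])
      fun x => div_ne_zero (hne x) (hne x₀)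
  have hcf : Continuous fun x => f x / f x₀ := f.continuous.div_const _
  have hslit : ∀ᶠ x in nhds x₀, f x / f x₀ ∈ Complex.slitPlane :=
    hcf.continuousAt.eventually_mem
      (Complex.isOpen_slitPlane.mem_nhds (by simp [div_self (hne x₀)]))
  have hcont : ∀ x, f x / f x₀ ∈ Complex.slitPlane → ContinuousAt g x := fun x hx =>
    ((Complex.continuousAt_arg hx).comp
      (f := fun x => f x / f x₀) hcf.continuousAt).div_const _
  have hsmall : ∀ᶠ x in nhds x₀, |g x| < 1 / 8 :=
    (hcont x₀ hslit.self_of_nhds).abs.eventually_lt_const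
      (by simp [hgdef, div_self (hne x₀)])
  obtain ⟨m, hm1, hm⟩ := S.exists_base_subset hx₀ (hslit.and hsmall)
  have hgm : ∀ x ∈ S.base m, |g x| < 1 / 8 := fun x hx => (hm hx).2
  have hgc : ∀ d, ContinuousOn g (S.base (m + d)) := fun d x hx =>
    (hcont x (hm (S.base_antitone (Nat.le_add_right m d) hx)).1).continuousWithinAt
  obtain ⟨V, W, hW, hV⟩ := hg.exists_decomposition S hgm
  have hMV : ∀ n, m ≤ n → _ := fun n hn => S.KRM_mulVec_of_increment hV hn
  have hPV := S.KRP_mulVec hMV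
  have hPW := S.KRP_mulVec_int hW hMV
  refine ⟨m, hm1, V m, W m, hW m, ?_, fun μ hμ hTμ d => ?_, fun N => ⟨N + 1, by omega, ?_⟩⟩
  · simp only [hPV]
    exact S.summable_norm hg hgm hV
  · rw [hPV]
    exact S.sum_measure_mul_eq_zero (hgc d) (hV _ (by omega)) μ hTμ
  · rw [hPW]
    exact fun hdvd => hα (S.exists_eigenfunction_of_dvd (hgc _) hk (hV _ (by omega)) (hW _) hdvd)
end
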